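/- Let S : ℝ → ℝ be locally bounded and subadditive with S(0) = 0, and suppose S satisfies the weak Heiberg–Seneta condition with respect to a locally Steinhaus–Weil set Σ ⊆ (0,∞) accumulating at 0, i.e. γ_Σ := limsup_{t↓0, t∈Σ} S(t)/t < ∞. Then S(t) ≤ γ_Σ·t for all t ≥ 0; in particular γ_S⁺ := limsup_{t↓0} S(t)/t ≤ γ_Σ < ∞, so S satisfies the strong Heiberg–Seneta condition. -/

import Mathlib

open Filter Topology Set Pointwise

/-- `S` is subadditive on `ℝ`. -/
def Subadditive' (S : ℝ → ℝ) : Prop := ∀ x y : ℝ, S (x + y) ≤ S x + S y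

/-- `S` is locally bounded: bounded on every bounded interval. -/
def LocallyBounded' (S : ℝ → ℝ) : Prop :=
  ∀ r : ℝ, 0 < r → ∃ M : ℝ, ∀ x : ℝ, |x| ≤ r → |S x| ≤ M

/-- `Σ ⊆ ℝ` is locally Steinhaus–Weil: for `x, y ∈ Σ` and all sufficiently small
`δ > 0`, `x + y` lies in the interior of `Σ_x^δ + Σ_y^δ` and `x - y` lies in the
interior of `Σ_x^δ - Σ_y^δ`, where `Σ_z^δ := Σ ∩ (z - δ, z + δ)`. -/
def LocallySW (Sig : Set ℝ) : Prop :=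
  ∀ x ∈ Sig, ∀ y ∈ Sig, ∃ δ₀ : ℝ, 0 < δ₀ ∧ ∀ δ : ℝ, 0 < δ → δ ≤ δ₀ →
    x + y ∈ interior ((Sig ∩ Set.Ioo (x - δ) (x + δ)) + (Sig ∩ Set.Ioo (y - δ) (y + δ))) ∧
    x - y ∈ interior ((Sig ∩ Set.Ioo (x - δ) (x + δ)) - (Sig ∩ Set.Ioo (y - δ) (y + δ)))

/-- `γ_S^Σ := limsup_{t↓0, t∈Σ} S t / t`, in the extended reals. -/
noncomputable def gammaSigma (S : ℝ → ℝ) (Sig : Set ℝ) : EReal :=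
  Filter.limsup (fun t : ℝ => ((S t / t : ℝ) : EReal)) (𝓝[Sig] (0 : ℝ))

/-- `γ_S⁺ := limsup_{t↓0} S t / t`, in the extended reals. -/
noncomputable def gammaPlus (S : ℝ → ℝ) : EReal :=
  Filter.limsup (fun t : ℝ => ((S t / t : ℝ) : EReal)) (𝓝[>] (0 : ℝ))

theorem Subadditive'.map_nat_mul_le {S : ℝ → ℝ} (hsub : Subadditive' S) (h0 : S 0 = 0)
    (n : ℕ) (y : ℝ) : S (n * y) ≤ n * S y := by
  induction n with
  | zero => simp [h0]
  | succ n ih =>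
    have h := hsub (n * y) y
    push_cast
    rw [add_one_mul, add_one_mul]
    linarith

/-- Near the double of a small point of a locally Steinhaus–Weil set, all points are sums of two
small points of the set. -/
theorem LocallySW.exists_sum_of_near {Sig : Set ℝ} (hSW : LocallySW Sig) {x η : ℝ}
    (hx : x ∈ Sig) (hxη : x < η) :
    ∃ ε > 0, ∀ z, |z - (x + x)| < ε → ∃ u ∈ Sig, ∃ v ∈ Sig, u < η ∧ v < η ∧ u + v = z := by
  obtain ⟨δ₀, hδ₀, h⟩ := hSW x hx x hx
  have hint := (h (min δ₀ (η - x)) (lt_min hδ₀ (sub_pos.2 hxη)) (min_le_left _ _)).1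
  obtain ⟨ε, hε, hball⟩ := Metric.mem_nhds_iff.1 (mem_interior_iff_mem_nhds.1 hint)
  refine ⟨ε, hε, fun z hz => ?_⟩
  obtain ⟨u, ⟨hu, -, hu'⟩, v, ⟨hv, -, hv'⟩, huv⟩ :=
    Set.mem_add.1 (hball (by rwa [Metric.mem_ball, Real.dist_eq]))
  have := min_le_right δ₀ (η - x)
  exact ⟨u, hu, v, hv, by linarith, by linarith, huv⟩

theorem exists_mem_pos_lt_of_accPt {Sig : Set ℝ} (hSig : Sig ⊆ Set.Ioi 0)
    (hacc : AccPt (0 : ℝ) (𝓟 Sig)) {η : ℝ} (hη : 0 < η) : ∃ x ∈ Sig, 0 < x ∧ x < η := by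
  obtain ⟨x, ⟨hxη, hx⟩, -⟩ := accPt_iff_nhds.1 hacc _ (Metric.ball_mem_nhds 0 hη)
  rw [Metric.mem_ball, Real.dist_eq, sub_zero] at hxη
  exact ⟨x, hx, hSig hx, (le_abs_self x).trans_lt hxη⟩

/-- A linear bound on the small points of a locally Steinhaus–Weil set accumulating at `0`
extends to all of `[0, ∞)`. -/
theorem Subadditive'.le_mul_of_forall_small {S : ℝ → ℝ} (hsub : Subadditive' S) (h0 : S 0 = 0)
    {Sig : Set ℝ} (hSig : Sig ⊆ Set.Ioi 0) (hSW : LocallySW Sig) (hacc : AccPt (0 : ℝ) (𝓟 Sig))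
    {c η : ℝ} (hη : 0 < η) (hc : ∀ s ∈ Sig, s < η → S s ≤ c * s) {t : ℝ} (ht : 0 ≤ t) :
    S t ≤ c * t := by
  rcases ht.eq_or_lt with rfl | ht
  · simp [h0]
  obtain ⟨x, hx, -, hxη⟩ :=
    exists_mem_pos_lt_of_accPt hSig hacc (lt_min hη (half_pos ht))
  obtain ⟨ε, hε, hsum⟩ := hSW.exists_sum_of_near hx (hxη.trans_le (min_le_left _ _))
  obtain ⟨y, hy, hy0, hyε⟩ := exists_mem_pos_lt_of_accPt hSig hacc (lt_min hη hε)
  have hxt : 0 ≤ t - (x + x) := by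
    have := min_le_right η (t / 2)
    linarith
  set n := ⌊(t - (x + x)) / y⌋₊
  have hn₁ : n * y ≤ t - (x + x) :=
    (le_div_iff₀ hy0).1 (Nat.floor_le (div_nonneg hxt hy0.le))
  have hn₂ : t - (x + x) < (n + 1) * y := (div_lt_iff₀ hy0).1 (Nat.lt_floor_add_one _)
  have hyε' := hyε.trans_le (min_le_right η ε)
  obtain ⟨u, hu, v, hv, huη, hvη, huv⟩ :=
    hsum (t - n * y) (by rw [abs_lt]; constructor <;> linarith)
  calc S t = S (u + v + n * y) := by rw [huv, sub_add_cancel]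
    _ ≤ S u + S v + n * S y :=
      (hsub _ _).trans (add_le_add (hsub u v) (hsub.map_nat_mul_le h0 n y))
    _ ≤ c * u + c * v + n * (c * y) := by
      gcongr
      · exact hc u hu huη
      · exact hc v hv hvη
      · exact hc y hy (hyε.trans_le (min_le_left _ _))
    _ = c * t := by linear_combination c * huv

theorem exists_forall_le_mul_of_gammaSigma_lt {S : ℝ → ℝ} {Sig : Set ℝ}
    (hSig : Sig ⊆ Set.Ioi 0) {c : ℝ} (hc : gammaSigma S Sig < c) :
    ∃ η > 0, ∀ s ∈ Sig, s < η → S s ≤ c * s := by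
  obtain ⟨η, hη, h⟩ := Metric.mem_nhdsWithin_iff.1 (eventually_lt_of_limsup_lt hc)
  refine ⟨η, hη, fun s hs hsη => ?_⟩
  have hs0 : 0 < s := hSig hs
  have hlt : ((S s / s : ℝ) : EReal) < c :=
    h ⟨by rwa [Metric.mem_ball, Real.dist_eq, sub_zero, abs_of_pos hs0], hs⟩
  exact ((div_lt_iff₀ hs0).1 (EReal.coe_lt_coe_iff.1 hlt)).le

theorem gammaPlus_le_of_forall_le_mul {S : ℝ → ℝ} {g : ℝ} (h : ∀ t, 0 ≤ t → S t ≤ g * t) :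
    gammaPlus S ≤ g := by
  refine limsup_le_of_le (by isBoundedDefault) ?_
  filter_upwards [self_mem_nhdsWithin] with t ht
  have ht0 : 0 < t := ht
  exact EReal.coe_le_coe_iff.2 ((div_le_iff₀ ht0).2 (h t ht0.le))

/-- Paper's Corollary to Theorem 0⁺: a locally bounded subadditive `S` with `S 0 = 0`
satisfying the weak Heiberg–Seneta condition `γ_S^Σ < ∞` (for some locally
Steinhaus–Weil `Σ ⊆ (0,∞)` accumulating at `0`) is linearly bounded:
`S t ≤ γ_S^Σ · t` for `t ≥ 0`; hence `γ_S⁺ ≤ γ_S^Σ < ∞`, i.e. `S` satisfies the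
strong Heiberg–Seneta condition. -/
theorem berz_corollary_WHS_SHS (S : ℝ → ℝ) (hlb : LocallyBounded' S)
    (hsub : Subadditive' S) (h0 : S 0 = 0)
    (Sig : Set ℝ) (hSig : Sig ⊆ Set.Ioi (0 : ℝ)) (hSW : LocallySW Sig)
    (hacc : AccPt (0 : ℝ) (𝓟 Sig))
    (hWHS : gammaSigma S Sig < ⊤) :
    (∀ t : ℝ, 0 ≤ t → (S t : EReal) ≤ gammaSigma S Sig * (t : EReal)) ∧
    gammaPlus S ≤ gammaSigma S Sig ∧ gammaPlus S < ⊤ := by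
  have key : ∀ c : ℝ, gammaSigma S Sig < c → ∀ t, 0 ≤ t → S t ≤ c * t := by
    intro c hc t ht
    obtain ⟨η, hη, h⟩ := exists_forall_le_mul_of_gammaSigma_lt hSig hc
    exact hsub.le_mul_of_forall_small h0 hSig hSW hacc hη h ht
  induction hg : gammaSigma S Sig with
  | top => exact absurd hg hWHS.ne
  | bot =>
    have h := key (S 1 - 1) (hg ▸ EReal.bot_lt_coe _) 1 zero_le_one
    linarith
  | coe g =>
    have hbound : ∀ t, 0 ≤ t → S t ≤ g * t := by
      intro t ht
      have hcont : Tendsto (fun c : ℝ => c * t) (𝓝[>] g) (𝓝 (g * t)) :=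
        ((continuous_id.mul continuous_const).tendsto g).mono_left nhdsWithin_le_nhds
      refine ge_of_tendsto hcont ?_
      filter_upwards [self_mem_nhdsWithin] with c hc
      exact key c (hg ▸ EReal.coe_lt_coe_iff.2 hc) t ht
    have hplus := gammaPlus_le_of_forall_le_mul hbound
    refine ⟨fun t ht => ?_, hplus, hplus.trans_lt (EReal.coe_lt_top g)⟩
    rw [← EReal.coe_mul]
    exact EReal.coe_le_coe_iff.2 (hbound t ht)
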